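/- Let R be an overlay TRS, let f(ℓ_1,…,ℓ_n) → r be a rule of R, and let θ' be a substitution such that xθ' is a normal form of R for every variable x in f(ℓ_1,…,ℓ_n). Then ℓ_iθ' is a normal form of R for every i ∈ {1,…,n}, and hence the root step f(ℓ_1θ',…,ℓ_nθ') →_{ε,R} rθ' is an innermost rewrite step. -/

import Mathlib

namespace RWS

/-- First-order terms over a signature `F` (function symbols of arbitrary arity,
realized by lists of arguments) and variables `V`. -/
inductive Term (F V : Type) : Type
  | var : V → Term F V
  | app : F → List (Term F V) → Term F V

namespace Term

variable {F V : Type}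

/-- `t` is a variable. -/
def IsVar : Term F V → Prop
  | var _ => True
  | app _ _ => False

/-- Application of a substitution (a map from variables to terms) to a term. -/
def subst (σ : V → Term F V) : Term F V → Term F V
  | var x => σ x
  | app f ts => app f (ts.attach.map fun t => t.1.subst σ)
decreasing_by
  simp_wf
  have := List.sizeOf_lt_of_mem t.2
  omega

/-- The list of variable occurrences of a term. -/
def varOccs : Term F V → List V
  | var x => [x]
  | app _ ts => (ts.attach.map fun t => t.1.varOccs).flatten
decreasing_by
  simp_wf
  have := List.sizeOf_lt_of_mem t.2
  omega

/-- A term is linear if no variable occurs in it more than once. -/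
def Linear (t : Term F V) : Prop := t.varOccs.Nodup

end Term

variable {F V : Type}

/-- `PSub t u` : `t` is a proper subterm of `u` (i.e. `u ▷ t`). -/
inductive PSub : Term F V → Term F V → Prop
  | head {t f ts} : t ∈ ts → PSub t (.app f ts)
  | tail {t u f ts} : PSub t u → u ∈ ts → PSub t (.app f ts)

/-- Subterm-or-equal relation. -/
def Sub (t u : Term F V) : Prop := t = u ∨ PSub t u

/-- The rewrite relation of a set `R` of rewrite rules: contraction of a redex
at some position (root rule instance, closed under contexts). -/
inductive Rew (R : Set (Term F V × Term F V)) : Term F V → Term F V → Prop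
  | root {l r : Term F V} {σ : V → Term F V} :
      (l, r) ∈ R → Rew R (l.subst σ) (r.subst σ)
  | congr {s t : Term F V} {f : F} {ts us : List (Term F V)} :
      Rew R s t → Rew R (.app f (ts ++ s :: us)) (.app f (ts ++ t :: us))

/-- `t` is a normal form of `R`. -/
def NormalForm (R : Set (Term F V × Term F V)) (t : Term F V) : Prop :=
  ∀ u, ¬ Rew R t u

/-- Innermost rewriting: contraction of a redex all of whose proper subterms
are normal forms of `R`. -/
inductive IRew (R : Set (Term F V × Term F V)) : Term F V → Term F V → Prop
  | root {l r : Term F V} {σ : V → Term F V} :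
      (l, r) ∈ R → (∀ u, PSub u (l.subst σ) → NormalForm R u) →
      IRew R (l.subst σ) (r.subst σ)
  | congr {s t : Term F V} {f : F} {ts us : List (Term F V)} :
      IRew R s t → IRew R (.app f (ts ++ s :: us)) (.app f (ts ++ t :: us))

/-- A rewrite step at the root position (`→_{ε}`). -/
def RootStep (R : Set (Term F V × Term F V)) (s t : Term F V) : Prop :=
  ∃ l r σ, (l, r) ∈ R ∧ s = Term.subst σ l ∧ t = Term.subst σ r

/-- A rewrite step strictly below the root (`→_{>ε}`). -/
def BelowRew (R : Set (Term F V × Term F V)) (s t : Term F V) : Prop :=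
  ∃ (f : F) (ts us : List (Term F V)) (a b : Term F V),
    Rew R a b ∧ s = .app f (ts ++ a :: us) ∧ t = .app f (ts ++ b :: us)

/-- An innermost rewrite step strictly below the root (`i→_{>ε}`). -/
def IBelowRew (R : Set (Term F V × Term F V)) (s t : Term F V) : Prop :=
  ∃ (f : F) (ts us : List (Term F V)) (a b : Term F V),
    IRew R a b ∧ s = .app f (ts ++ a :: us) ∧ t = .app f (ts ++ b :: us)

/-- `R` is a term rewrite system: left-hand sides are not variables and
variables of right-hand sides occur in the corresponding left-hand sides. -/
def IsTRS (R : Set (Term F V × Term F V)) : Prop :=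
  ∀ p ∈ R, ¬ p.1.IsVar ∧ ∀ x ∈ p.2.varOccs, x ∈ p.1.varOccs

/-- All right-hand sides are linear. -/
def RightLinear (R : Set (Term F V × Term F V)) : Prop :=
  ∀ p ∈ R, p.2.Linear

/-- No right-hand side is a variable. -/
def NonCollapsing (R : Set (Term F V × Term F V)) : Prop :=
  ∀ p ∈ R, ¬ p.2.IsVar

/-- `R` has an inner-overlap: a proper non-variable subterm of some left-hand
side is unifiable (after renaming the rules apart, equivalently: some instance
of the one equals some instance of the other) with some left-hand side. -/
def InnerOverlap (R : Set (Term F V × Term F V)) : Prop :=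
  ∃ l r l' r' u, (l, r) ∈ R ∧ (l', r') ∈ R ∧ PSub u l ∧ ¬ u.IsVar ∧
    ∃ σ τ : V → Term F V, u.subst σ = l'.subst τ

/-- `R` is an overlay system. -/
def Overlay (R : Set (Term F V × Term F V)) : Prop := ¬ InnerOverlap R

/-- The term `t` is terminating w.r.t. `R`: no infinite rewrite sequence starts from `t`. -/
def Terminating (R : Set (Term F V × Term F V)) (t : Term F V) : Prop :=
  ¬ ∃ f : ℕ → Term F V, f 0 = t ∧ ∀ n, Rew R (f n) (f (n + 1))

/-- The TRS `R` is terminating: there is no infinite rewrite sequence. -/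
def TerminatingTRS (R : Set (Term F V × Term F V)) : Prop :=
  ¬ ∃ f : ℕ → Term F V, ∀ n, Rew R (f n) (f (n + 1))

/-- The TRS `R` is innermost terminating: there is no infinite innermost rewrite sequence. -/
def InnermostTerminatingTRS (R : Set (Term F V × Term F V)) : Prop :=
  ¬ ∃ f : ℕ → Term F V, ∀ n, IRew R (f n) (f (n + 1))

/-- Domain of a substitution. -/
def Dom (σ : V → Term F V) : Set V := {x | σ x ≠ .var x}

end RWS

namespace RWS

variable {F V : Type}

/-- Embedding of terms over the signature `F` into terms over the extended
signature `F ⊕ F`, where `Sum.inl f` is the original symbol `f` and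
`Sum.inr f` is the fresh tuple symbol `f#`. -/
def Term.lift : Term F V → Term (F ⊕ F) V
  | .var x => .var x
  | .app f ts => .app (Sum.inl f) (ts.attach.map fun t => t.1.lift)
decreasing_by
  simp_wf
  have := List.sizeOf_lt_of_mem t.2
  omega

/-- The TRS `R` viewed over the extended signature `F ⊕ F`. -/
def liftTRS (R : Set (Term F V × Term F V)) :
    Set (Term (F ⊕ F) V × Term (F ⊕ F) V) :=
  { p | ∃ l r, (l, r) ∈ R ∧ p = (l.lift, r.lift) }

/-- The defined symbols of `R`: root symbols of left-hand sides. -/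
def DefinedSym (R : Set (Term F V × Term F V)) : Set F :=
  { f | ∃ ts r, (Term.app f ts, r) ∈ R }

/-- `t#`: the term `f(t₁,…,tₙ)` with its root replaced by the tuple symbol `f#`. -/
def Term.sharp : Term F V → Term (F ⊕ F) V
  | .var x => .var x
  | .app f ts => .app (Sum.inr f) (ts.attach.map fun t => t.1.lift)

/-- The set of dependency pairs of `R`: rules `ℓ# → t#` where `ℓ → r ∈ R` and
`t` is a subterm of `r` whose root symbol is defined. -/
def DP (R : Set (Term F V × Term F V)) :
    Set (Term (F ⊕ F) V × Term (F ⊕ F) V) :=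
  { p | ∃ l r t, (l, r) ∈ R ∧ Sub t r ∧
        (∃ g ts, t = Term.app g ts ∧ g ∈ DefinedSym R) ∧
        p = (l.sharp, t.sharp) }

/-- There is an infinite minimal `(P,R)`-chain
`t₀ →_{>ε,R}* s₀ →_{ε,P} t₁ →_{>ε,R}* s₁ →_{ε,P} t₂ ⋯` (all proper subterms of
the `tᵢ` are terminating w.r.t. `R`). -/
def InfMinChain (P R : Set (Term F V × Term F V)) : Prop :=
  ∃ t s : ℕ → Term F V,
    (∀ i, Relation.ReflTransGen (BelowRew R) (t i) (s i)) ∧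
    (∀ i, RootStep P (s i) (t (i + 1))) ∧
    (∀ i v, PSub v (t i) → Terminating R v)

/-- There is an infinite innermost minimal `(P,R)`-chain: as above, where the
below-root `R`-steps are innermost and each root `P`-step is applied to a term
all of whose proper subterms are normal forms of `R`. -/
def InfInnMinChain (P R : Set (Term F V × Term F V)) : Prop :=
  ∃ t s : ℕ → Term F V,
    (∀ i, Relation.ReflTransGen (IBelowRew R) (t i) (s i)) ∧
    (∀ i v, PSub v (s i) → NormalForm R v) ∧
    (∀ i, RootStep P (s i) (t (i + 1))) ∧
    (∀ i v, PSub v (t i) → Terminating R v)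

/-- Finite minimal `(P,R)`-chains of length `n` (number of root `P`-steps),
from the first term to the term reached right after the `n`-th root `P`-step. -/
inductive MinChainN (P R : Set (Term F V × Term F V)) :
    ℕ → Term F V → Term F V → Prop
  | refl {t : Term F V} :
      (∀ v, PSub v t → Terminating R v) → MinChainN P R 0 t t
  | step {n : ℕ} {t₀ t s t' : Term F V} :
      MinChainN P R n t₀ t →
      Relation.ReflTransGen (BelowRew R) t s →
      RootStep P s t' →
      (∀ v, PSub v t' → Terminating R v) →
      MinChainN P R (n + 1) t₀ t'

/-- Finite innermost minimal `(P,R)`-chains of length `n`. -/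
inductive InnMinChainN (P R : Set (Term F V × Term F V)) :
    ℕ → Term F V → Term F V → Prop
  | refl {t : Term F V} :
      (∀ v, PSub v t → Terminating R v) → InnMinChainN P R 0 t t
  | step {n : ℕ} {t₀ t s t' : Term F V} :
      InnMinChainN P R n t₀ t →
      Relation.ReflTransGen (IBelowRew R) t s →
      (∀ v, PSub v s → NormalForm R v) →
      RootStep P s t' →
      (∀ v, PSub v t' → Terminating R v) →
      InnMinChainN P R (n + 1) t₀ t'

end RWS

namespace RWS

theorem Term.subst_app {F V : Type} (σ : V → Term F V) (f : F) (ts : List (Term F V)) :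
    (Term.app f ts).subst σ = .app f (ts.map (Term.subst σ)) := by
  simp [Term.subst]

theorem Term.mem_varOccs_app {F V : Type} {x : V} {f : F} {ts : List (Term F V)} :
    x ∈ (Term.app f ts).varOccs ↔ ∃ t ∈ ts, x ∈ t.varOccs := by
  simp [Term.varOccs]

theorem NormalForm.of_mem {F V : Type} {R : Set (Term F V × Term F V)} {f : F}
    {ts : List (Term F V)} {t : Term F V} (h : NormalForm R (.app f ts)) (ht : t ∈ ts) :
    NormalForm R t := by
  intro u hu
  obtain ⟨as, bs, rfl⟩ := List.append_of_mem ht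
  exact h _ (.congr hu)

theorem NormalForm.of_psub {F V : Type} {R : Set (Term F V × Term F V)} {s t : Term F V}
    (hst : PSub s t) (h : NormalForm R t) : NormalForm R s := by
  induction hst with
  | head hs => exact h.of_mem hs
  | tail _ hu ih => exact ih (h.of_mem hu)

theorem PSub.trans {F V : Type} {s t u : Term F V} (hst : PSub s t) (htu : PSub t u) :
    PSub s u := by
  induction htu with
  | head ht => exact .tail hst ht
  | tail _ hu ih => exact .tail ih hu

/-- An application is a normal form if its arguments are and it is not itself an
instance of a left-hand side. -/
theorem NormalForm.app {F V : Type} {R : Set (Term F V × Term F V)} {f : F}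
    {ts : List (Term F V)} (hts : ∀ t ∈ ts, NormalForm R t)
    (hroot : ∀ l r, (l, r) ∈ R → ∀ τ, Term.app f ts ≠ l.subst τ) :
    NormalForm R (.app f ts) := by
  intro u hu
  generalize hs : Term.app f ts = s at hu
  cases hu with
  | root hlr => exact hroot _ _ hlr _ hs
  | congr hst =>
    obtain ⟨-, rfl⟩ := Term.app.inj hs
    exact hts _ (by simp) _ hst

/-- In an overlay system, a proper subterm of a left-hand side instantiated by
normal forms is a normal form. -/
theorem Overlay.normalForm_subst_of_psub {F V : Type} {R : Set (Term F V × Term F V)}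
    (hOV : Overlay R) {l r : Term F V} (hlr : (l, r) ∈ R) {θ : V → Term F V}
    (u : Term F V) (hul : PSub u l) (hθ : ∀ x ∈ u.varOccs, NormalForm R (θ x)) :
    NormalForm R (u.subst θ) := by
  match u with
  | .var x =>
    simpa only [Term.subst] using hθ x (by simp [Term.varOccs])
  | .app f ts =>
    rw [Term.subst_app]
    refine .app ?_ fun l' r' hlr' τ h ↦ hOV
      ⟨l, r, l', r', .app f ts, hlr, hlr', hul, id, θ, τ, by rw [Term.subst_app, h]⟩
    intro t ht
    obtain ⟨v, hv, rfl⟩ := List.mem_map.mp ht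
    exact hOV.normalForm_subst_of_psub hlr v (PSub.trans (.head hv) hul)
      fun x hx ↦ hθ x (Term.mem_varOccs_app.mpr ⟨v, hv, hx⟩)
termination_by sizeOf u
decreasing_by
  have := List.sizeOf_lt_of_mem hv
  simp
  omega

/-- Let `R` be an overlay TRS, `f(ℓ₁,…,ℓₙ) → r ∈ R`, and
`θ'` a substitution with `xθ'` a normal form of `R` for every variable `x` of
the left-hand side. Then every `ℓᵢθ'` is a normal form of `R` (so every proper
subterm of `f(ℓ₁θ',…,ℓₙθ')` is), and hence the root step
`f(ℓ₁θ',…,ℓₙθ') →_{ε,R} rθ'` is an innermost rewrite step. -/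
theorem lhs_args_instance_normalForm_and_root_step_innermost
    {F V : Type} (R : Set (Term F V × Term F V))
    (hTRS : IsTRS R) (hOV : Overlay R)
    (f : F) (ls : List (Term F V)) (r : Term F V)
    (hrule : (Term.app f ls, r) ∈ R)
    (θ' : V → Term F V)
    (hθ : ∀ x ∈ (Term.app f ls : Term F V).varOccs, NormalForm R (θ' x)) :
    (∀ l ∈ ls, NormalForm R (l.subst θ')) ∧
    (∀ u, PSub u ((Term.app f ls : Term F V).subst θ') → NormalForm R u) ∧
    IRew R ((Term.app f ls : Term F V).subst θ') (r.subst θ') := by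
  have hargs : ∀ l ∈ ls, NormalForm R (l.subst θ') := fun l hl ↦
    hOV.normalForm_subst_of_psub hrule l (.head hl)
      fun x hx ↦ hθ x (Term.mem_varOccs_app.mpr ⟨l, hl, hx⟩)
  have hsub : ∀ u, PSub u ((Term.app f ls : Term F V).subst θ') → NormalForm R u := by
    intro u hu
    rw [Term.subst_app] at hu
    cases hu with
    | head hmem =>
      obtain ⟨l, hl, rfl⟩ := List.mem_map.mp hmem
      exact hargs l hl
    | tail hut hmem =>
      obtain ⟨l, hl, rfl⟩ := List.mem_map.mp hmem
      exact (hargs l hl).of_psub hut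
  exact ⟨hargs, hsub, .root hrule hsub⟩

end RWS
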